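/- Let f : [a,b] → ℝ be bounded and continuous almost everywhere with ER(f) = [inf_{[a,b]} f, sup_{[a,b]} f]. Let {Λ_n = {λ_{1,n},…,λ_{d_n,n}}}_n be a sequence of finite multisets of real numbers with d_n → ∞, and assume (i) {Λ_n}_n ∼ f, and (ii) Λ_n ⊆ [inf_{[a,b]} f − ε_n, sup_{[a,b]} f + ε_n] for every n, for some ε_n → 0. Then, for every asymptotically uniform grid {x_{i,n}}_{i=1,…,d_n} in [a,b] with all points contained in [a,b], if σ_n and τ_n are permutations of {1,…,d_n} such that the vectors [f(x_{σ_n(1),n}),…,f(x_{σ_n(d_n),n})] and [λ_{τ_n(1),n},…,λ_{τ_n(d_n),n}] are sorted in increasing order, then max_{i=1,…,d_n} |f(x_{σ_n(i),n}) − λ_{τ_n(i),n}| → 0 as n → ∞. -/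

import Mathlib

open MeasureTheory Filter

/-- The integral of a function of the integer part is a finite sum. -/
theorem intervalIntegral_comp_floor (φ : ℕ → ℝ) (n : ℕ) :
    IntervalIntegrable (fun s : ℝ => φ ⌊s⌋₊) volume 0 n ∧
      ∫ s in (0 : ℝ)..n, φ ⌊s⌋₊ = ∑ k ∈ Finset.range n, φ k := by
  induction n with
  | zero => simp
  | succ n ih =>
    have hle : (n : ℝ) ≤ ((n + 1 : ℕ) : ℝ) := by push_cast; linarith
    have hconst : Set.EqOn (fun _ : ℝ => φ n) (fun s : ℝ => φ ⌊s⌋₊)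
        (Set.Ioo (n : ℝ) ((n + 1 : ℕ) : ℝ)) := by
      intro s hs
      have : ⌊s⌋₊ = n := by
        rw [Nat.floor_eq_iff (le_trans (Nat.cast_nonneg n) hs.1.le)]
        exact ⟨hs.1.le, by simpa using hs.2⟩
      simp only [this]
    have hint : IntervalIntegrable (fun s : ℝ => φ ⌊s⌋₊) volume n ((n + 1 : ℕ) : ℝ) := by
      rw [intervalIntegrable_iff_integrableOn_Ioo_of_le hle]
      refine IntegrableOn.congr_fun ?_ hconst measurableSet_Ioo
      exact integrableOn_const (by simp)
    refine ⟨ih.1.trans hint, ?_⟩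
    rw [← intervalIntegral.integral_add_adjacent_intervals ih.1 hint, ih.2,
      Finset.sum_range_succ, intervalIntegral.integral_of_le hle, integral_Ioc_eq_integral_Ioo,
      ← setIntegral_congr_fun measurableSet_Ioo hconst]
    simp

/-- Riemann sums with equal weights as integrals of step functions. -/
theorem setIntegral_Icc_comp_floor {a b : ℝ} (hab : a < b) (φ : ℕ → ℝ) {d : ℕ} (hd : 0 < d) :
    (d : ℝ)⁻¹ * ∑ k ∈ Finset.range d, φ k =
      (b - a)⁻¹ * ∫ t in Set.Icc a b, φ ⌊(t - a) * (d / (b - a))⌋₊ := by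
  have hba : b - a ≠ 0 := (sub_pos.2 hab).ne'
  have hd' : (d : ℝ) ≠ 0 := by positivity
  have hc : (d : ℝ) / (b - a) ≠ 0 := div_ne_zero hd' hba
  rw [integral_Icc_eq_integral_Ioc, ← intervalIntegral.integral_of_le hab.le,
    intervalIntegral.integral_comp_sub_right (fun s => φ ⌊s * (d / (b - a))⌋₊) a,
    intervalIntegral.integral_comp_mul_right (fun s => φ ⌊s⌋₊) hc, sub_self, zero_mul,
    mul_div_cancel₀ _ hba, (intervalIntegral_comp_floor φ d).2]
  simp only [smul_eq_mul]
  field_simp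

/-- For an a.u. grid, the grid value at the cell of a point `t` tends to `f t` wherever `f` is
continuous. -/
theorem tendsto_grid_cell {a b : ℝ} (hab : a < b) {f : ℝ → ℝ} {dn : ℕ → ℕ}
    (hd : Tendsto dn atTop atTop) {y : ℕ → ℕ → ℝ} (hy : ∀ n k, y n k ∈ Set.Icc a b)
    {m : ℕ → ℝ} (hm : Tendsto m atTop (nhds 0))
    (hym : ∀ n, ∀ k < dn n, |y n k - (a + ((k : ℝ) + 1) * (b - a) / (dn n : ℝ))| ≤ m n)
    {t : ℝ} (ht : t ∈ Set.Ico a b) (hf : ContinuousWithinAt f (Set.Icc a b) t) :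
    Tendsto (fun n => f (y n ⌊(t - a) * (dn n / (b - a))⌋₊)) atTop (nhds (f t)) := by
  have hba : 0 < b - a := sub_pos.2 hab
  refine hf.tendsto.comp (tendsto_nhdsWithin_iff.2 ⟨?_, Eventually.of_forall fun n => hy n _⟩)
  have hlim : Tendsto (fun n => m n + (b - a) / (dn n : ℝ)) atTop (nhds 0) := by
    simpa using hm.add
      ((tendsto_const_nhds (x := b - a)).div_atTop (tendsto_natCast_atTop_atTop.comp hd))
  rw [tendsto_iff_dist_tendsto_zero]
  refine squeeze_zero' (Eventually.of_forall fun n => dist_nonneg) ?_ hlim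
  filter_upwards [hd.eventually_gt_atTop 0] with n hn
  have hn' : (0 : ℝ) < dn n := by exact_mod_cast hn
  set s : ℝ := (t - a) * (dn n / (b - a)) with hs
  have hts : t = a + s * ((b - a) / dn n) := by rw [hs]; field_simp; ring
  have hs0 : 0 ≤ s := mul_nonneg (sub_nonneg.2 ht.1) (by positivity)
  have hsd : s < dn n := by
    rw [hs, mul_div_assoc', div_lt_iff₀ hba, mul_comm]
    exact mul_lt_mul_of_pos_left (by linarith [ht.2]) hn'
  have hk := hym n ⌊s⌋₊ ((Nat.floor_lt hs0).2 hsd)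
  have h1 := Nat.floor_le hs0
  have h2 := Nat.lt_floor_add_one s
  have hw : 0 < (b - a) / (dn n : ℝ) := by positivity
  have hcell : |(a + ((⌊s⌋₊ : ℝ) + 1) * (b - a) / (dn n : ℝ)) - t| ≤ (b - a) / dn n := by
    have : (a + ((⌊s⌋₊ : ℝ) + 1) * (b - a) / (dn n : ℝ)) - t
        = ((⌊s⌋₊ : ℝ) + 1 - s) * ((b - a) / dn n) := by
      conv_lhs => rw [hts]
      ring
    rw [this, abs_of_nonneg (mul_nonneg (by linarith) hw.le)]
    exact mul_le_of_le_one_left hw.le (by linarith)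
  calc dist (y n ⌊s⌋₊) t ≤ _ := abs_sub_le _ (a + ((⌊s⌋₊ : ℝ) + 1) * (b - a) / (dn n : ℝ)) _
    _ ≤ _ := add_le_add hk hcell

/-- A function continuous a.e. on `[a,b]` is a.e. measurable, and if it is bounded its averages
over an a.u. grid have the distribution of `f`. -/
theorem tendsto_average_grid {a b : ℝ} (hab : a < b) {f : ℝ → ℝ} {C : ℝ}
    (hC : ∀ x ∈ Set.Icc a b, |f x| ≤ C)
    (hf : ∀ᵐ x ∂(volume.restrict (Set.Icc a b)), ContinuousWithinAt f (Set.Icc a b) x)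
    {dn : ℕ → ℕ} (hd : Tendsto dn atTop atTop)
    {x : ∀ n, Fin (dn n) → ℝ} (hx : ∀ n i, x n i ∈ Set.Icc a b)
    (hau : Tendsto (fun n => ⨆ i : Fin (dn n),
        |x n i - (a + (((i : ℕ) : ℝ) + 1) * (b - a) / (dn n : ℝ))|) atTop (nhds 0)) :
    AEStronglyMeasurable f (volume.restrict (Set.Icc a b)) ∧
    ∀ F : ℝ → ℝ, Continuous F →
      Tendsto (fun n => (dn n : ℝ)⁻¹ * ∑ i : Fin (dn n), F (f (x n i))) atTop
        (nhds ((b - a)⁻¹ * ∫ y in Set.Icc a b, F (f y))) := by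
  let y : ℕ → ℕ → ℝ := fun n k => if h : k < dn n then x n ⟨k, h⟩ else a
  have hy : ∀ n k, y n k ∈ Set.Icc a b := by
    intro n k
    by_cases h : k < dn n
    · simpa only [y, dif_pos h] using hx n _
    · simpa only [y, dif_neg h] using Set.left_mem_Icc.2 hab.le
  have hyx : ∀ n (i : Fin (dn n)), y n i = x n i := fun n i => by simp [y]
  have hym : ∀ n, ∀ k < dn n, |y n k - (a + ((k : ℝ) + 1) * (b - a) / (dn n : ℝ))| ≤
      ⨆ i : Fin (dn n), |x n i - (a + (((i : ℕ) : ℝ) + 1) * (b - a) / (dn n : ℝ))| := by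
    intro n k hk
    simp only [y, dif_pos hk]
    exact le_ciSup (f := fun i : Fin (dn n) =>
      |x n i - (a + (((i : ℕ) : ℝ) + 1) * (b - a) / (dn n : ℝ))|)
      (Set.finite_range _).bddAbove ⟨k, hk⟩
  have hlim : ∀ᵐ t ∂(volume.restrict (Set.Icc a b)),
      Tendsto (fun n => f (y n ⌊(t - a) * (dn n / (b - a))⌋₊)) atTop (nhds (f t)) := by
    rw [← restrict_Ico_eq_restrict_Icc] at hf ⊢
    filter_upwards [hf, ae_restrict_mem measurableSet_Ico] with t hft ht
    exact tendsto_grid_cell hab hd hy hau hym ht hft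
  have hmeas : ∀ (φ : ℕ → ℝ) (c : ℝ), Measurable fun t : ℝ => φ ⌊(t - a) * c⌋₊ := fun φ c =>
    (measurable_from_top (f := φ)).comp
      (Nat.measurable_floor.comp ((measurable_id.sub_const a).mul_const c))
  refine ⟨aestronglyMeasurable_of_tendsto_ae atTop (fun n =>
    (hmeas (fun k => f (y n k)) _).aestronglyMeasurable) hlim, fun F hF => ?_⟩
  obtain ⟨B, hB⟩ := (isCompact_Icc (a := -C) (b := C)).exists_bound_of_continuousOn hF.continuousOn
  have hconv : Tendsto (fun n => ∫ t in Set.Icc a b, F (f (y n ⌊(t - a) * (dn n / (b - a))⌋₊)))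
      atTop (nhds (∫ t in Set.Icc a b, F (f t))) := by
    refine tendsto_integral_of_dominated_convergence (fun _ => B)
      (fun n => (hmeas (fun k => F (f (y n k))) _).aestronglyMeasurable)
      (integrable_const B)
      (fun n => Eventually.of_forall fun t => hB _ (abs_le.1 (hC _ (hy n _)))) ?_
    filter_upwards [hlim] with t ht
    exact (hF.tendsto _).comp ht
  refine (hconv.const_mul (b - a)⁻¹).congr' ?_
  filter_upwards [hd.eventually_gt_atTop 0] with n hn
  rw [← setIntegral_Icc_comp_floor hab (fun k => F (f (y n k))) hn,
    ← Fin.sum_univ_eq_sum_range (fun k => F (f (y n k)))]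
  simp only [hyx]

/-- Convergence of averages against compactly supported functions extends to all continuous
functions when the points are eventually uniformly bounded. -/
theorem tendsto_average_of_compactSupport {a b : ℝ} (hab : a < b) {f : ℝ → ℝ} {C : ℝ}
    (hC : ∀ x ∈ Set.Icc a b, |f x| ≤ C) {dn : ℕ → ℕ} {lam : ∀ n, Fin (dn n) → ℝ}
    (hdistr : ∀ F : ℝ → ℂ, Continuous F → HasCompactSupport F →
      Tendsto (fun n => (dn n : ℂ)⁻¹ * ∑ i : Fin (dn n), F (lam n i)) atTop
        (nhds (((volume (Set.Icc a b)).toReal)⁻¹ • ∫ y in Set.Icc a b, F (f y))))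
    (hlam : ∀ᶠ n in atTop, ∀ i, |lam n i| ≤ C) (F : ℝ → ℝ) (hF : Continuous F) :
    Tendsto (fun n => (dn n : ℝ)⁻¹ * ∑ i : Fin (dn n), F (lam n i)) atTop
      (nhds ((b - a)⁻¹ * ∫ y in Set.Icc a b, F (f y))) := by
  let G : ℝ → ℝ := fun t => F t * max 0 (min 1 (C + 1 - |t|))
  have hG : Continuous G := by fun_prop
  have hGF : ∀ t, |t| ≤ C → G t = F t := by
    intro t ht
    have : min 1 (C + 1 - |t|) = 1 := min_eq_left (by linarith)
    simp [G, this]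
  have hGs : HasCompactSupport G := by
    refine HasCompactSupport.intro (isCompact_Icc (a := -(C + 1)) (b := C + 1)) fun t ht => ?_
    have h : C + 1 < |t| := by
      by_contra! h
      exact ht (abs_le.1 h)
    have : max 0 (min 1 (C + 1 - |t|)) = 0 :=
      max_eq_left ((min_le_right _ _).trans (by linarith))
    simp [G, this]
  have key := hdistr (fun t => (G t : ℂ)) (by fun_prop) (hGs.comp_left Complex.ofReal_zero)
  have hre := (Complex.continuous_re.tendsto _).comp key
  have hvol : (volume (Set.Icc a b)).toReal = b - a := by
    rw [Real.volume_Icc, ENNReal.toReal_ofReal (sub_nonneg.2 hab.le)]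
  have hint : ∫ y in Set.Icc a b, G (f y) = ∫ y in Set.Icc a b, F (f y) :=
    setIntegral_congr_fun measurableSet_Icc fun y hy => hGF _ (hC y hy)
  rw [integral_complex_ofReal, Complex.smul_re, Complex.ofReal_re, hvol, smul_eq_mul, hint] at hre
  refine hre.congr' ?_
  filter_upwards [hlam] with n hn
  have hcast : (dn n : ℂ)⁻¹ * ∑ i : Fin (dn n), ((G (lam n i) : ℝ) : ℂ)
      = (((dn n : ℝ)⁻¹ * ∑ i : Fin (dn n), G (lam n i) : ℝ) : ℂ) := by push_cast; rfl
  simp only [Function.comp_apply, hcast, Complex.ofReal_re]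
  rw [Finset.sum_congr rfl fun i _ => hGF _ (hn i)]

/-- A continuous ramp equal to `1` below `z` and to `0` above `w`. -/
noncomputable def ramp (z w t : ℝ) : ℝ := max 0 (min 1 ((w - t) / (w - z)))

theorem continuous_ramp (z w : ℝ) : Continuous (ramp z w) := by
  unfold ramp; fun_prop

theorem ramp_nonneg (z w t : ℝ) : 0 ≤ ramp z w t := le_max_left _ _

theorem ramp_le_one (z w t : ℝ) : ramp z w t ≤ 1 := max_le zero_le_one (min_le_left _ _)

theorem ramp_eq_one {z w t : ℝ} (h : z < w) (ht : t ≤ z) : ramp z w t = 1 := by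
  have : 1 ≤ (w - t) / (w - z) := (one_le_div (by linarith)).2 (by linarith)
  rw [ramp, min_eq_left this, max_eq_right zero_le_one]

theorem ramp_eq_zero {z w t : ℝ} (h : z < w) (ht : w ≤ t) : ramp z w t = 0 :=
  max_eq_left ((min_le_right _ _).trans
    (div_nonpos_of_nonpos_of_nonneg (by linarith) (by linarith)))

theorem ramp_pos {z w t : ℝ} (h : z < w) (ht : t < w) : 0 < ramp z w t :=
  lt_max_of_lt_right (lt_min one_pos (div_pos (by linarith) (by linarith)))

theorem ramp_lt_one {z w t : ℝ} (h : z < w) (ht : z < t) : ramp z w t < 1 :=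
  max_lt one_pos (min_lt_of_right_lt ((div_lt_one (by linarith)).2 (by linarith)))

/-- If the distribution charges the midpoint of `(z, w)`, the integrals of the left and right
ramps are strictly ordered. -/
theorem integral_ramp_lt {a b : ℝ} {f : ℝ → ℝ}
    (hf : AEStronglyMeasurable f (volume.restrict (Set.Icc a b))) {z w : ℝ} (hzw : z < w)
    (hER : ∀ ε : ℝ, 0 < ε → 0 < volume {x ∈ Set.Icc a b | |f x - (z + w) / 2| < ε}) :
    ∫ y in Set.Icc a b, ramp z ((z + w) / 2) (f y) <
      ∫ y in Set.Icc a b, ramp ((z + w) / 2) w (f y) := by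
  set c := (z + w) / 2 with hc
  have hzc : z < c := by linarith
  have hcw : c < w := by linarith
  have hint : ∀ p q : ℝ, Integrable (fun y => ramp p q (f y)) (volume.restrict (Set.Icc a b)) :=
    fun p q => Integrable.of_bound ((continuous_ramp p q).comp_aestronglyMeasurable hf) 1
      (Eventually.of_forall fun y => by
        rw [Real.norm_of_nonneg (ramp_nonneg _ _ _)]
        exact ramp_le_one _ _ _)
  have hnn : ∀ t, 0 ≤ ramp c w t - ramp z c t := by
    intro t
    rcases le_total t c with h | h
    · rw [ramp_eq_one hcw h]; linarith [ramp_le_one z c t]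
    · rw [ramp_eq_zero hzc h]; linarith [ramp_nonneg c w t]
  have hpos : ∀ t, z < t → t < w → 0 < ramp c w t - ramp z c t := by
    intro t h1 h2
    rcases le_total t c with h | h
    · rw [ramp_eq_one hcw h]; linarith [ramp_lt_one hzc h1]
    · rw [ramp_eq_zero hzc h]; linarith [ramp_pos hcw h2]
  rw [← sub_pos, ← integral_sub (hint _ _) (hint _ _),
    integral_pos_iff_support_of_nonneg (fun y => hnn (f y)) ((hint _ _).sub (hint _ _)),
    Measure.restrict_apply' measurableSet_Icc]
  refine (hER ((w - z) / 2) (by linarith)).trans_le (measure_mono ?_)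
  rintro y ⟨hy, hlt⟩
  rw [abs_lt] at hlt
  exact ⟨ne_of_gt (hpos _ (by linarith [hlt.1]) (by linarith [hlt.2])), hy⟩

/-- Comparison of counting functions of two families with the same limit distribution. -/
theorem eventually_card_le {dn : ℕ → ℕ} (hd : Tendsto dn atTop atTop)
    {u v : ∀ n, Fin (dn n) → ℝ} {z w I J : ℝ} (hzw : z < w)
    (hu : Tendsto (fun n => (dn n : ℝ)⁻¹ * ∑ i, ramp z ((z + w) / 2) (u n i)) atTop (nhds I))
    (hv : Tendsto (fun n => (dn n : ℝ)⁻¹ * ∑ i, ramp ((z + w) / 2) w (v n i)) atTop (nhds J))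
    (hIJ : I < J) :
    ∀ᶠ n in atTop, (Finset.univ.filter fun i => u n i ≤ z).card ≤
      (Finset.univ.filter fun i => v n i < w).card := by
  filter_upwards [hu.eventually_lt hv hIJ, hd.eventually_gt_atTop 0] with n hn hd0
  have hlt := lt_of_mul_lt_mul_left hn (by positivity)
  have h1 : ((Finset.univ.filter fun i => u n i ≤ z).card : ℝ) ≤
      ∑ i, ramp z ((z + w) / 2) (u n i) := by
    rw [Finset.card_filter, Nat.cast_sum]
    refine Finset.sum_le_sum fun i _ => ?_
    split_ifs with h
    · rw [ramp_eq_one (by linarith) h]; simp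
    · simpa using ramp_nonneg _ _ _
  have h2 : ∑ i, ramp ((z + w) / 2) w (v n i) ≤
      ((Finset.univ.filter fun i => v n i < w).card : ℝ) := by
    rw [Finset.card_filter, Nat.cast_sum]
    refine Finset.sum_le_sum fun i _ => ?_
    split_ifs with h
    · simpa using ramp_le_one _ _ _
    · rw [ramp_eq_zero (by linarith) (not_lt.1 h)]; simp
  exact_mod_cast (h1.trans hlt.le).trans h2

/-- If at least as many entries of `v` lie below `w` as entries of `u` lie below `z`, then the
increasing rearrangements satisfy `v i < w` whenever `u i ≤ z`. -/
theorem sorted_lt_of_card_le {d : ℕ} {u v : Fin d → ℝ} {σ τ : Equiv.Perm (Fin d)}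
    (hσ : Monotone fun i => u (σ i)) (hτ : Monotone fun i => v (τ i)) {z w : ℝ}
    (hcard : (Finset.univ.filter fun i => u i ≤ z).card ≤
      (Finset.univ.filter fun i => v i < w).card) {i : Fin d} (hi : u (σ i) ≤ z) :
    v (τ i) < w := by
  by_contra! hw
  have h1 : (Finset.Iic i).card ≤ (Finset.univ.filter fun i => u i ≤ z).card := by
    refine Finset.card_le_card_of_injOn σ (fun j hj => ?_) σ.injective.injOn
    simpa using (hσ (Finset.mem_Iic.1 hj)).trans hi
  have h2 : (Finset.univ.filter fun i => v i < w).card ≤ (Finset.Iio i).card := by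
    refine Finset.card_le_card_of_injOn τ.symm (fun j hj => ?_) τ.symm.injective.injOn
    have hj' : v j < w := by simpa using hj
    simp only [Finset.coe_Iio, Set.mem_Iio]
    by_contra! hij
    have := hτ hij
    simp only [Equiv.apply_symm_apply] at this
    linarith
  rw [Fin.card_Iic] at h1
  rw [Fin.card_Iio] at h2
  omega

/-- One-sided uniform comparison of the increasing rearrangements of two families having the same
limit distribution, whose support is `[m, M]`. -/
theorem eventually_sorted_le {a b : ℝ} (hab : a < b) {f : ℝ → ℝ} {m M : ℝ}
    (hf : AEStronglyMeasurable f (volume.restrict (Set.Icc a b)))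
    (hER : ∀ z ∈ Set.Icc m M, ∀ ε : ℝ, 0 < ε → 0 < volume {x ∈ Set.Icc a b | |f x - z| < ε})
    {dn : ℕ → ℕ} (hd : Tendsto dn atTop atTop) {u v : ∀ n, Fin (dn n) → ℝ}
    (hu : ∀ F : ℝ → ℝ, Continuous F →
      Tendsto (fun n => (dn n : ℝ)⁻¹ * ∑ i, F (u n i)) atTop
        (nhds ((b - a)⁻¹ * ∫ y in Set.Icc a b, F (f y))))
    (hv : ∀ F : ℝ → ℝ, Continuous F →
      Tendsto (fun n => (dn n : ℝ)⁻¹ * ∑ i, F (v n i)) atTop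
        (nhds ((b - a)⁻¹ * ∫ y in Set.Icc a b, F (f y))))
    {σ τ : ∀ n, Equiv.Perm (Fin (dn n))}
    (hσ : ∀ n, Monotone fun i => u n (σ n i)) (hτ : ∀ n, Monotone fun i => v n (τ n i))
    {δ : ℝ} (hδ : 0 < δ) (hum : ∀ᶠ n in atTop, ∀ i, m - δ / 4 ≤ u n i)
    (hvM : ∀ᶠ n in atTop, ∀ i, v n i ≤ M + δ / 4) :
    ∀ᶠ n in atTop, ∀ i, v n (τ n i) ≤ u n (σ n i) + δ := by
  have hcount : ∀ᶠ n in atTop, ∀ k ∈ Finset.range (⌈(M - m) / (δ / 4)⌉₊ + 1),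
      m + (k + 1) * (δ / 4) ≤ M →
      (Finset.univ.filter fun i => u n i ≤ m + k * (δ / 4)).card ≤
        (Finset.univ.filter fun i => v n i < m + (k + 1) * (δ / 4)).card := by
    rw [Filter.eventually_all_finset]
    intro k _
    by_cases hk : m + ((k : ℝ) + 1) * (δ / 4) ≤ M
    · have hzw : m + (k : ℝ) * (δ / 4) < m + ((k : ℝ) + 1) * (δ / 4) := by linarith
      have hk0 : 0 ≤ (k : ℝ) * (δ / 4) := by positivity
      filter_upwards [eventually_card_le hd hzw (hu _ (continuous_ramp _ _))
        (hv _ (continuous_ramp _ _)) (mul_lt_mul_of_pos_left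
          (integral_ramp_lt hf hzw (hER _ ⟨by linarith, by linarith⟩))
          (inv_pos.2 (sub_pos.2 hab)))] with n hn _ using hn
    · exact Eventually.of_forall fun n h => absurd h hk
  filter_upwards [hcount, hum, hvM] with n hn hun hvn i
  by_contra! hlt
  have hu' := hun (σ n i)
  have hv' := hvn (τ n i)
  set l := max (u n (σ n i)) m with hl
  have hlm : m ≤ l := le_max_right _ _
  have hlu : u n (σ n i) ≤ l := le_max_left _ _
  have hlu' : l ≤ u n (σ n i) + δ / 4 := max_le (by linarith) (by linarith)
  have hq : 0 < δ / 4 := by positivity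
  have h0 : 0 ≤ (l - m) / (δ / 4) := div_nonneg (by linarith) hq.le
  have hk1 := Nat.le_ceil ((l - m) / (δ / 4))
  have hk2 := Nat.ceil_lt_add_one h0
  rw [div_le_iff₀ hq] at hk1
  rw [← sub_lt_iff_lt_add, lt_div_iff₀ hq] at hk2
  have hmem : ⌈(l - m) / (δ / 4)⌉₊ ∈ Finset.range (⌈(M - m) / (δ / 4)⌉₊ + 1) := by
    rw [Finset.mem_range, Nat.lt_succ_iff]
    exact Nat.ceil_mono (div_le_div_of_nonneg_right (by linarith) hq.le)
  have := sorted_lt_of_card_le (hσ n) (hτ n) (hn _ hmem (by linarith)) (i := i) (by linarith)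
  linarith

/-- (Corollary `eccoGi-n`.) Let `f : [a,b] → ℝ` be bounded and continuous
a.e. with essential range `[inf f, sup f]`. If the multisets `Λ_n = {λ_{1,n},…,λ_{d_n,n}}`
have asymptotic distribution `f` and `Λ_n ⊆ [inf f − ε_n, sup f + ε_n]` with `ε_n → 0`, then
for every a.u. grid `{x_{i,n}} ⊂ [a,b]` and sorting permutations `σ_n, τ_n`, one has
`max_i |f(x_{σ_n(i),n}) − λ_{τ_n(i),n}| → 0`. -/
theorem stmt_1
    (a b : ℝ) (hab : a < b)
    (f : ℝ → ℝ)
    (hfbdd : ∃ C : ℝ, ∀ x ∈ Set.Icc a b, |f x| ≤ C)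
    (hfcont : ∀ᵐ x ∂(volume.restrict (Set.Icc a b)), ContinuousWithinAt f (Set.Icc a b) x)
    (hER : {z : ℝ | ∀ ε : ℝ, 0 < ε → 0 < volume {x ∈ Set.Icc a b | |f x - z| < ε}}
      = Set.Icc (sInf (f '' Set.Icc a b)) (sSup (f '' Set.Icc a b)))
    (dn : ℕ → ℕ) (hd : Tendsto dn atTop atTop)
    (lam : ∀ n, Fin (dn n) → ℝ)
    (hdistr : ∀ F : ℝ → ℂ, Continuous F → HasCompactSupport F →
      Tendsto (fun n => (dn n : ℂ)⁻¹ * ∑ i : Fin (dn n), F (lam n i)) atTop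
        (nhds (((volume (Set.Icc a b)).toReal)⁻¹ • ∫ y in Set.Icc a b, F (f y))))
    (ε : ℕ → ℝ) (hε : Tendsto ε atTop (nhds 0))
    (hlam : ∀ n i, lam n i ∈
      Set.Icc (sInf (f '' Set.Icc a b) - ε n) (sSup (f '' Set.Icc a b) + ε n))
    (x : ∀ n, Fin (dn n) → ℝ) (hx : ∀ n i, x n i ∈ Set.Icc a b)
    (hau : Tendsto (fun n => ⨆ i : Fin (dn n),
        |x n i - (a + (((i : ℕ) : ℝ) + 1) * (b - a) / (dn n : ℝ))|) atTop (nhds 0))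
    (σ τ : ∀ n, Equiv.Perm (Fin (dn n)))
    (hσ : ∀ n, Monotone fun i => f (x n (σ n i)))
    (hτ : ∀ n, Monotone fun i => lam n (τ n i)) :
    Tendsto (fun n => ⨆ i : Fin (dn n), |f (x n (σ n i)) - lam n (τ n i)|)
      atTop (nhds 0) := by
  obtain ⟨C, hC⟩ := hfbdd
  set m := sInf (f '' Set.Icc a b)
  set M := sSup (f '' Set.Icc a b)
  have hbelow : BddBelow (f '' Set.Icc a b) :=
    ⟨-C, by rintro _ ⟨t, ht, rfl⟩; exact (abs_le.1 (hC t ht)).1⟩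
  have habove : BddAbove (f '' Set.Icc a b) :=
    ⟨C, by rintro _ ⟨t, ht, rfl⟩; exact (abs_le.1 (hC t ht)).2⟩
  have hmf : ∀ t ∈ Set.Icc a b, m ≤ f t := fun t ht => csInf_le hbelow ⟨t, ht, rfl⟩
  have hfM : ∀ t ∈ Set.Icc a b, f t ≤ M := fun t ht => le_csSup habove ⟨t, ht, rfl⟩
  obtain ⟨hmeas, hgrid⟩ := tendsto_average_grid hab hC hfcont hd hx hau
  have hεlt : ∀ δ : ℝ, 0 < δ → ∀ᶠ n in atTop, ε n < δ := fun δ hδ => hε.eventually_lt_const hδ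
  have hlamavg := tendsto_average_of_compactSupport (C := |m| + |M| + 1) hab
    (fun t ht => abs_le.2 ⟨by linarith [hmf t ht, neg_abs_le m, abs_nonneg M],
      by linarith [hfM t ht, le_abs_self M, abs_nonneg m]⟩) hdistr (by
    filter_upwards [hεlt 1 one_pos] with n hn i
    exact abs_le.2 ⟨by linarith [(hlam n i).1, neg_abs_le m, abs_nonneg M],
      by linarith [(hlam n i).2, le_abs_self M, abs_nonneg m]⟩)
  have hER' : ∀ z ∈ Set.Icc m M, ∀ ε : ℝ, 0 < ε →
      0 < volume {x ∈ Set.Icc a b | |f x - z| < ε} := fun z hz => hER.symm.subset hz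
  rw [Metric.tendsto_nhds]
  intro δ hδ
  have hδ2 : 0 < δ / 2 := by positivity
  have hsmall := hεlt (δ / 2 / 4) (by positivity)
  have hle := eventually_sorted_le hab hmeas hER' hd hgrid hlamavg hσ hτ hδ2
    (Eventually.of_forall fun n i => by linarith [hmf _ (hx n i)])
    (hsmall.mono fun n hn i => by linarith [(hlam n i).2])
  have hge := eventually_sorted_le hab hmeas hER' hd hlamavg hgrid hτ hσ hδ2
    (hsmall.mono fun n hn i => by linarith [(hlam n i).1])
    (Eventually.of_forall fun n i => by linarith [hfM _ (hx n i)])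
  filter_upwards [hle, hge] with n h1 h2
  rw [Real.dist_0_eq_abs, abs_of_nonneg (Real.iSup_nonneg fun i => abs_nonneg _)]
  refine (Real.iSup_le (fun i => abs_le.2 ⟨?_, ?_⟩) hδ2.le).trans_lt (half_lt_self hδ)
  · linarith [h1 i]
  · linarith [h2 i]
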